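/- arXiv:1503.07691 — 3 statements merged into one kernel-verified Lean document; each statement's English description precedes it below -/
import Mathlib

section
/- Let f : {0,1}^n → {0,1} be a non-constant Boolean function with s_1(f) > 1. Then C_0(f) ≤ 2^{s_1(f)-1} · (s_0(f) − 1/3). -/
/-- The input `x` with its `i`-th coordinate flipped. -/
def flipCoord {n : ℕ} (x : Fin n → Bool) (i : Fin n) : Fin n → Bool :=
  Function.update x i (!(x i))

/-- The sensitivity `s(f, x)` of a Boolean function `f` on input `x`:
the number of coordinates whose flip changes the value of `f`. -/
def sensAt {n : ℕ} (f : (Fin n → Bool) → Bool) (x : Fin n → Bool) : ℕ :=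
  (Finset.univ.filter fun i => f (flipCoord x i) ≠ f x).card

/-- The `b`-sensitivity `s_b(f)`: the maximum of `s(f, x)` over inputs `x` with `f x = b`. -/
def bSens {n : ℕ} (f : (Fin n → Bool) → Bool) (b : Bool) : ℕ :=
  (Finset.univ.filter fun x => f x = b).sup (sensAt f)

/-- The certificate complexity `C(f, x)`: the minimum size of a set `P` of coordinates
such that fixing the coordinates in `P` to their values in `x` forces the value of `f`. -/
noncomputable def certAt {n : ℕ} (f : (Fin n → Bool) → Bool) (x : Fin n → Bool) : ℕ :=
  sInf {k | ∃ P : Finset (Fin n), P.card = k ∧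
    ∀ y : Fin n → Bool, (∀ i ∈ P, y i = x i) → f y = f x}

/-- The `b`-certificate complexity `C_b(f)`: the maximum of `C(f, x)` over `x` with `f x = b`. -/
noncomputable def bCert {n : ℕ} (f : (Fin n → Bool) → Bool) (b : Bool) : ℕ :=
  (Finset.univ.filter fun x => f x = b).sup (certAt f)

/-- A Boolean function is non-constant if it takes two different values. -/
def NonConstant {n : ℕ} (f : (Fin n → Bool) → Bool) : Prop :=
  ∃ x y, f x ≠ f y

section Flip

variable {n : ℕ}

theorem flipCoord_same (x : Fin n → Bool) (i : Fin n) : flipCoord x i i = !(x i) := by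
  simp [flipCoord]

theorem flipCoord_of_ne (x : Fin n → Bool) {i j : Fin n} (h : j ≠ i) :
    flipCoord x i j = x j := by
  simp [flipCoord, h]

theorem flipCoord_apply (x : Fin n → Bool) (i j : Fin n) :
    flipCoord x i j = if j = i then !(x j) else x j := by
  by_cases h : j = i
  · subst h; simp [flipCoord]
  · simp [flipCoord, h]

@[simp] theorem flipCoord_flipCoord (x : Fin n → Bool) (i : Fin n) :
    flipCoord (flipCoord x i) i = x := by
  ext j
  by_cases h : j = i <;> simp [flipCoord_apply, h]

theorem flipCoord_comm (x : Fin n → Bool) (i j : Fin n) :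
    flipCoord (flipCoord x i) j = flipCoord (flipCoord x j) i := by
  ext k
  simp only [flipCoord_apply]
  split_ifs <;> rfl

theorem flipCoord_injective (i : Fin n) :
    Function.Injective fun x : Fin n → Bool => flipCoord x i :=
  Function.LeftInverse.injective (g := fun x => flipCoord x i) fun x => flipCoord_flipCoord x i

/-- The subcube through `x` in which exactly the coordinates in `T` are free. -/
def subcube (x : Fin n → Bool) (T : Finset (Fin n)) : Finset (Fin n → Bool) :=
  Finset.univ.filter fun y => ∀ i, i ∉ T → y i = x i

theorem mem_subcube {x y : Fin n → Bool} {T : Finset (Fin n)} :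
    y ∈ subcube x T ↔ ∀ i, i ∉ T → y i = x i := by
  simp [subcube]

theorem self_mem_subcube (x : Fin n → Bool) (T : Finset (Fin n)) : x ∈ subcube x T := by
  simp [subcube]

theorem subcube_univ (x : Fin n → Bool) : subcube x Finset.univ = Finset.univ := by
  ext; simp [subcube]

theorem subcube_empty (x : Fin n → Bool) : subcube x ∅ = {x} := by
  ext y; simp [subcube, funext_iff]

theorem subcube_eq_of_mem {x y : Fin n → Bool} {T : Finset (Fin n)} (h : y ∈ subcube x T) :
    subcube y T = subcube x T := by
  ext w
  rw [mem_subcube] at h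
  simp only [mem_subcube]
  exact forall₂_congr fun i hi => by rw [h i hi]

theorem flipCoord_mem_subcube {x y : Fin n → Bool} {T : Finset (Fin n)} {j : Fin n}
    (hj : j ∈ T) : flipCoord y j ∈ subcube x T ↔ y ∈ subcube x T := by
  simp only [mem_subcube]
  refine forall₂_congr fun i hi => ?_
  rw [flipCoord_of_ne _ (by rintro rfl; exact hi hj)]

theorem flipCoord_notMem_subcube {x y : Fin n → Bool} {T : Finset (Fin n)} {j : Fin n}
    (hj : j ∉ T) (hy : y ∈ subcube x T) : flipCoord y j ∉ subcube x T := by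
  intro h
  have h1 := mem_subcube.1 h j hj
  have h2 := mem_subcube.1 hy j hj
  rw [flipCoord_same, h2] at h1
  cases hx : x j <;> simp [hx] at h1

theorem flipCoord_mem_subcube_flipCoord {x y : Fin n → Bool} {T : Finset (Fin n)} {j : Fin n} :
    flipCoord y j ∈ subcube (flipCoord x j) T ↔ y ∈ subcube x T := by
  simp only [mem_subcube]
  refine forall₂_congr fun i _ => ?_
  simp only [flipCoord_apply]
  split_ifs <;> simp

theorem subcube_insert (x : Fin n → Bool) (T : Finset (Fin n)) (i : Fin n) :
    subcube x (insert i T) = subcube x T ∪ subcube (flipCoord x i) T := by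
  ext y
  simp only [Finset.mem_union, mem_subcube, Finset.mem_insert, not_or]
  constructor
  · intro h
    by_cases hi : y i = x i
    · left
      intro j hj
      by_cases hji : j = i
      · rw [hji, hi]
      · exact h j ⟨hji, hj⟩
    · right
      intro j hj
      by_cases hji : j = i
      · subst hji
        rw [flipCoord_same]
        cases hx : x j <;> cases hy : y j <;> simp_all
      · rw [flipCoord_of_ne _ hji]
        exact h j ⟨hji, hj⟩
  · rintro (h | h) j ⟨hji, hj⟩
    · exact h j hj
    · rw [h j hj, flipCoord_of_ne _ hji]

theorem disjoint_subcube_flipCoord (x : Fin n → Bool) {T : Finset (Fin n)} {i : Fin n}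
    (hi : i ∉ T) : Disjoint (subcube x T) (subcube (flipCoord x i) T) := by
  rw [Finset.disjoint_left]
  intro y hy hy'
  have := flipCoord_notMem_subcube hi hy'
  have h := (flipCoord_mem_subcube_flipCoord (x := x) (T := T) (j := i) (y := y)).2 hy
  exact this h

theorem card_inter_subcube_insert (A : Finset (Fin n → Bool)) (x : Fin n → Bool)
    {T : Finset (Fin n)} {i : Fin n} (hi : i ∉ T) :
    (A ∩ subcube x (insert i T)).card =
      (A ∩ subcube x T).card + (A ∩ subcube (flipCoord x i) T).card := by
  rw [subcube_insert, Finset.inter_union_distrib_left, Finset.card_union_of_disjoint]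
  exact (disjoint_subcube_flipCoord x hi).mono Finset.inter_subset_right Finset.inter_subset_right

theorem card_subcube (x : Fin n → Bool) (T : Finset (Fin n)) :
    (subcube x T).card = 2 ^ T.card := by
  induction T using Finset.induction_on generalizing x with
  | empty => simp [subcube_empty]
  | insert i T hi ih =>
    have := card_inter_subcube_insert Finset.univ x hi
    simp only [Finset.univ_inter] at this
    rw [this, ih, ih, Finset.card_insert_of_notMem hi, pow_succ]
    ring

/-- The number of neighbours of `a`, in the directions of `T`, lying outside `A`. -/
def outDegree (A : Finset (Fin n → Bool)) (T : Finset (Fin n)) (a : Fin n → Bool) : ℕ :=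
  (T.filter fun i => flipCoord a i ∉ A).card

theorem outDegree_mono (A : Finset (Fin n → Bool)) {S T : Finset (Fin n)} (h : S ⊆ T)
    (a : Fin n → Bool) : outDegree A S a ≤ outDegree A T a :=
  Finset.card_le_card (Finset.filter_subset_filter _ h)

theorem outDegree_insert_of_notMem {A : Finset (Fin n → Bool)} {T : Finset (Fin n)} {i : Fin n}
    (hi : i ∉ T) {a : Fin n → Bool} (ha : flipCoord a i ∉ A) :
    outDegree A (insert i T) a = outDegree A T a + 1 := by
  rw [outDegree, Finset.filter_insert, if_pos ha, Finset.card_insert_of_notMem (by simp [hi])]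
  rfl

/-- Simon's lemma: a nonempty subset of a cube with at most `t` outside neighbours at each of its
points has density at least `2 ^ (-t)`. -/
theorem two_pow_le_card_of_outDegree_le (A : Finset (Fin n → Bool)) (T : Finset (Fin n))
    (x : Fin n → Bool) (t : ℕ) (hne : (A ∩ subcube x T).Nonempty)
    (h : ∀ a ∈ A ∩ subcube x T, outDegree A T a ≤ t) :
    2 ^ T.card ≤ 2 ^ t * (A ∩ subcube x T).card := by
  induction T using Finset.induction_on generalizing x t with
  | empty =>
    have := hne.card_pos
    have h2 : 0 < 2 ^ t := by positivity
    simp only [Finset.card_empty, pow_zero]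
    exact Nat.succ_le_of_lt (Nat.mul_pos h2 this)
  | insert i T hi ih =>
    have key : ∀ x : Fin n → Bool, (A ∩ subcube x (insert i T)).Nonempty →
        (∀ a ∈ A ∩ subcube x (insert i T), outDegree A (insert i T) a ≤ t) →
        A ∩ subcube x T = ∅ →
        2 ^ (insert i T).card ≤ 2 ^ t * (A ∩ subcube x (insert i T)).card := by
      intro x hne h h0
      rw [card_inter_subcube_insert A x hi, h0, Finset.card_insert_of_notMem hi]
      have hout : ∀ a ∈ A ∩ subcube (flipCoord x i) T, outDegree A T a + 1 ≤ t := by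
        intro a ha
        rw [Finset.mem_inter] at ha
        rw [← outDegree_insert_of_notMem hi]
        · exact h a (by simp [subcube_insert, ha.1, ha.2])
        · intro hA
          have : flipCoord a i ∈ A ∩ subcube x T :=
            Finset.mem_inter.2 ⟨hA, by
              have := (flipCoord_mem_subcube_flipCoord (j := i)).2 ha.2
              rwa [flipCoord_flipCoord] at this⟩
          simp [h0] at this
      have hne' : (A ∩ subcube (flipCoord x i) T).Nonempty := by
        rwa [subcube_insert, Finset.inter_union_distrib_left, h0, Finset.empty_union] at hne
      obtain ⟨a, ha⟩ := hne'
      obtain ⟨t, rfl⟩ : ∃ u, t = u + 1 := ⟨t - 1, by have := hout a ha; omega⟩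
      have := ih (flipCoord x i) t ⟨a, ha⟩ fun b hb => by have := hout b hb; omega
      rw [Finset.card_empty, zero_add, pow_succ, pow_succ]
      linarith
    have hflip : subcube (flipCoord x i) (insert i T) = subcube x (insert i T) :=
      subcube_eq_of_mem ((flipCoord_mem_subcube (by simp)).2 (self_mem_subcube x _))
    rcases Finset.eq_empty_or_nonempty (A ∩ subcube x T) with h0 | h0
    · exact key x hne h h0
    rcases Finset.eq_empty_or_nonempty (A ∩ subcube (flipCoord x i) T) with h1 | h1
    · rw [← hflip] at hne h ⊢
      exact key _ hne h h1
    have hle : ∀ y ∈ subcube x (insert i T), (A ∩ subcube y T).Nonempty →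
        2 ^ T.card ≤ 2 ^ t * (A ∩ subcube y T).card := by
      intro y hy hyne
      refine ih y t hyne fun a ha => (outDegree_mono A (Finset.subset_insert i T) a).trans (h a ?_)
      rw [Finset.mem_inter] at ha ⊢
      refine ⟨ha.1, ?_⟩
      rw [← subcube_eq_of_mem hy, subcube_insert]
      exact Finset.mem_union_left _ ha.2
    have e0 := hle x (self_mem_subcube x _) h0
    have e1 := hle (flipCoord x i) ((flipCoord_mem_subcube (by simp)).2 (self_mem_subcube x _)) h1
    rw [card_inter_subcube_insert A x hi, Finset.card_insert_of_notMem hi, pow_succ, mul_add]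
    linarith

theorem le_outDegree_of_inter_eq_subcube {A : Finset (Fin n → Bool)} {T R : Finset (Fin n)}
    {x c a : Fin n → Bool} {t : ℕ} (hA : A ∩ subcube x T = subcube c R)
    (hT : T.card = R.card + t) (ha : a ∈ A ∩ subcube x T) : t ≤ outDegree A T a := by
  have hsub : T \ R ⊆ T.filter fun i => flipCoord a i ∉ A := by
    intro j hj
    rw [Finset.mem_sdiff] at hj
    refine Finset.mem_filter.2 ⟨hj.1, fun hjA => ?_⟩
    refine flipCoord_notMem_subcube hj.2 (hA ▸ ha) ?_
    rw [← hA, Finset.mem_inter, flipCoord_mem_subcube hj.1]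
    exact ⟨hjA, (Finset.mem_inter.1 ha).2⟩
  have h1 := Finset.card_le_card hsub
  have h2 := Finset.le_card_sdiff R T
  unfold outDegree
  omega

theorem flipCoord_mem_of_inter_eq_subcube {A : Finset (Fin n → Bool)} {T R : Finset (Fin n)}
    {x c a : Fin n → Bool} {t : ℕ} {i : Fin n} (hi : i ∉ T)
    (hA : A ∩ subcube x T = subcube c R) (hT : T.card = R.card + t) (ha : a ∈ A ∩ subcube x T)
    (h : outDegree A (insert i T) a ≤ t) : flipCoord a i ∈ A := by
  by_contra hn
  rw [outDegree_insert_of_notMem hi hn] at h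
  have := le_outDegree_of_inter_eq_subcube hA hT ha
  omega

theorem card_le_of_half_eq_subcube {A : Finset (Fin n → Bool)} {T R : Finset (Fin n)}
    {x c : Fin n → Bool} {t : ℕ} {i : Fin n} (hi : i ∉ T)
    (hA : A ∩ subcube x T = subcube c R) (hT : T.card = R.card + t)
    (h : ∀ a ∈ A ∩ subcube x (insert i T), outDegree A (insert i T) a ≤ t)
    (hbig : 3 * 2 ^ T.card ≤ 2 ^ (t + 1) * (A ∩ subcube (flipCoord x i) T).card) :
    3 * 2 ^ (insert i T).card ≤ 2 ^ (t + 1) * (A ∩ subcube x (insert i T)).card := by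
  have hflip0 : ∀ a ∈ A ∩ subcube x T, flipCoord a i ∈ A := by
    intro a ha
    refine flipCoord_mem_of_inter_eq_subcube hi hA hT ha (h a ?_)
    rw [subcube_insert, Finset.inter_union_distrib_left]
    exact Finset.mem_union_left _ ha
  have hcard0 : (A ∩ subcube x T).card = 2 ^ R.card := by rw [hA, card_subcube]
  have hpos : 0 < 2 ^ R.card := by positivity
  have hpost : 0 < 2 ^ t := by positivity
  obtain ⟨b, hb, hbi⟩ : ∃ b ∈ A ∩ subcube (flipCoord x i) T, flipCoord b i ∉ A := by
    by_contra! hcon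
    have hle : (A ∩ subcube (flipCoord x i) T).card ≤ (A ∩ subcube x T).card := by
      refine Finset.card_le_card_of_injOn (fun y => flipCoord y i) ?_
        (flipCoord_injective i).injOn
      intro y hy
      have hy := Finset.mem_coe.1 hy
      refine Finset.mem_coe.2 (Finset.mem_inter.2 ⟨hcon y hy, ?_⟩)
      have := (flipCoord_mem_subcube_flipCoord (j := i)).2 (Finset.mem_inter.1 hy).2
      rwa [flipCoord_flipCoord] at this
    rw [hcard0] at hle
    have := hbig.trans (Nat.mul_le_mul_left _ hle)
    rw [hT, pow_add, pow_succ] at this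
    nlinarith [Nat.mul_pos hpos hpost]
  have hbx : flipCoord b i ∈ subcube x T := by
    have := (flipCoord_mem_subcube_flipCoord (j := i)).2 (Finset.mem_inter.1 hb).2
    rwa [flipCoord_flipCoord] at this
  have hcx : c ∈ subcube x T := (Finset.mem_inter.1 (hA ▸ self_mem_subcube c R)).2
  obtain ⟨d, hdR, hd⟩ : ∃ d, d ∉ R ∧ flipCoord b i d ≠ c d := by
    by_contra! hcon
    have : flipCoord b i ∈ subcube c R := mem_subcube.2 hcon
    rw [← hA] at this
    exact hbi (Finset.mem_inter.1 this).1
  have hdT : d ∈ T := by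
    by_contra hdT
    exact hd ((mem_subcube.1 hbx d hdT).trans (mem_subcube.1 hcx d hdT).symm)
  have hdi : d ≠ i := by rintro rfl; exact hi hdT
  rw [flipCoord_of_ne _ hdi] at hd
  have hsubE : subcube b (T.erase d) ⊆ subcube (flipCoord x i) T := by
    intro y hy
    rw [← subcube_eq_of_mem (Finset.mem_inter.1 hb).2]
    exact mem_subcube.2 fun j hj => mem_subcube.1 hy j fun hj' => hj (Finset.mem_of_mem_erase hj')
  have hout : ∀ a ∈ A ∩ subcube b (T.erase d), outDegree A (T.erase d) a + 1 ≤ t := by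
    intro a ha
    have haA := (Finset.mem_inter.1 ha).1
    have hax := hsubE (Finset.mem_inter.1 ha).2
    have had : a d = b d := mem_subcube.1 (Finset.mem_inter.1 ha).2 d (by simp)
    have hai : flipCoord a i ∉ A := by
      intro hcon
      have hmem : flipCoord a i ∈ A ∩ subcube x T := by
        refine Finset.mem_inter.2 ⟨hcon, ?_⟩
        have := (flipCoord_mem_subcube_flipCoord (j := i)).2 hax
        rwa [flipCoord_flipCoord] at this
      rw [hA] at hmem
      have := mem_subcube.1 hmem d hdR
      rw [flipCoord_of_ne _ hdi, had] at this
      exact hd this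
    have h1 := h a (by
      rw [subcube_insert, Finset.inter_union_distrib_left]
      exact Finset.mem_union_right _ (Finset.mem_inter.2 ⟨haA, hax⟩))
    rw [outDegree_insert_of_notMem hi hai] at h1
    have := outDegree_mono A (Finset.erase_subset d T) a
    omega
  have hbE : b ∈ A ∩ subcube b (T.erase d) :=
    Finset.mem_inter.2 ⟨(Finset.mem_inter.1 hb).1, self_mem_subcube _ _⟩
  obtain ⟨u, rfl⟩ : ∃ u, t = u + 1 := ⟨t - 1, by have := hout b hbE; omega⟩
  have hsimon := two_pow_le_card_of_outDegree_le A (T.erase d) b u ⟨b, hbE⟩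
    fun a ha => by have := hout a ha; omega
  have hTe : (T.erase d).card = R.card + u := by
    rw [Finset.card_erase_of_mem hdT]; omega
  rw [hTe, pow_add, mul_comm] at hsimon
  have hE : 2 ^ R.card ≤ (A ∩ subcube b (T.erase d)).card :=
    Nat.le_of_mul_le_mul_left hsimon (by positivity)
  have hdisj : Disjoint (subcube (flipCoord c i) R) (A ∩ subcube b (T.erase d)) := by
    rw [Finset.disjoint_left]
    intro y hy hy'
    have h1 := mem_subcube.1 hy d hdR
    have h2 := mem_subcube.1 (Finset.mem_inter.1 hy').2 d (by simp)
    rw [flipCoord_of_ne _ hdi] at h1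
    exact hd (h2.symm.trans h1)
  have hunion : subcube (flipCoord c i) R ∪ (A ∩ subcube b (T.erase d)) ⊆
      A ∩ subcube (flipCoord x i) T := by
    refine Finset.union_subset ?_ (Finset.inter_subset_inter_left hsubE)
    intro y hy
    have hy1 : flipCoord y i ∈ A ∩ subcube x T := by
      have := (flipCoord_mem_subcube_flipCoord (j := i)).2 hy
      rwa [flipCoord_flipCoord, ← hA] at this
    have hy2 := hflip0 _ hy1
    rw [flipCoord_flipCoord] at hy2
    refine Finset.mem_inter.2 ⟨hy2, ?_⟩
    have := (flipCoord_mem_subcube_flipCoord (j := i)).2 (Finset.mem_inter.1 hy1).2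
    rwa [flipCoord_flipCoord] at this
  have hcard := Finset.card_le_card hunion
  rw [Finset.card_union_of_disjoint hdisj, card_subcube] at hcard
  rw [card_inter_subcube_insert A x hi, hcard0, Finset.card_insert_of_notMem hi, hT]
  have h3 : 3 * 2 ^ R.card ≤ 2 ^ R.card + (A ∩ subcube (flipCoord x i) T).card := by omega
  calc 3 * 2 ^ (R.card + (u + 1) + 1) = 2 ^ (u + 1 + 1) * (3 * 2 ^ R.card) := by ring
    _ ≤ _ := Nat.mul_le_mul_left _ h3

/-- Stability in Simon's lemma: a nonempty subset of a cube with at most `t` outside neighbours at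
each of its points is a subcube of codimension `t` or has density at least
`3 / 2 ^ (t + 1)`. -/
theorem eq_subcube_or_card_le_of_outDegree_le (A : Finset (Fin n → Bool)) (T : Finset (Fin n))
    (x : Fin n → Bool) (t : ℕ) (hne : (A ∩ subcube x T).Nonempty)
    (h : ∀ a ∈ A ∩ subcube x T, outDegree A T a ≤ t) :
    (∃ c R, R ⊆ T ∧ A ∩ subcube x T = subcube c R ∧ T.card = R.card + t) ∨
      3 * 2 ^ T.card ≤ 2 ^ (t + 1) * (A ∩ subcube x T).card := by
  induction T using Finset.induction_on generalizing x t with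
  | empty =>
    rw [subcube_empty] at hne ⊢
    have hx : x ∈ A := by
      obtain ⟨y, hy⟩ := hne
      simp only [Finset.mem_inter, Finset.mem_singleton] at hy
      exact hy.2 ▸ hy.1
    have hAx : A ∩ {x} = {x} := by simpa using hx
    rcases Nat.eq_zero_or_pos t with rfl | ht
    · exact Or.inl ⟨x, ∅, subset_rfl, by rw [hAx, subcube_empty], rfl⟩
    · right
      obtain ⟨u, rfl⟩ : ∃ u, t = u + 1 := ⟨t - 1, by omega⟩
      have : 0 < 2 ^ u := by positivity
      rw [hAx, Finset.card_empty, Finset.card_singleton, pow_succ, pow_succ]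
      omega
  | insert i T hi ih =>
    have hmem : ∀ x y : Fin n → Bool, y ∈ subcube (flipCoord x i) T ↔
        flipCoord y i ∈ subcube x T := by
      intro x y
      have := flipCoord_mem_subcube_flipCoord (x := flipCoord x i) (y := y) (T := T) (j := i)
      rw [flipCoord_flipCoord] at this
      exact this.symm
    have key : ∀ x : Fin n → Bool, (A ∩ subcube x (insert i T)).Nonempty →
        (∀ a ∈ A ∩ subcube x (insert i T), outDegree A (insert i T) a ≤ t) →
        A ∩ subcube x T = ∅ →
        (∃ c R, R ⊆ insert i T ∧ A ∩ subcube x (insert i T) = subcube c R ∧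
          (insert i T).card = R.card + t) ∨
        3 * 2 ^ (insert i T).card ≤ 2 ^ (t + 1) * (A ∩ subcube x (insert i T)).card := by
      intro x hne h h0
      have heq : A ∩ subcube x (insert i T) = A ∩ subcube (flipCoord x i) T := by
        rw [subcube_insert, Finset.inter_union_distrib_left, h0, Finset.empty_union]
      rw [heq] at hne h ⊢
      have hout : ∀ a ∈ A ∩ subcube (flipCoord x i) T, outDegree A T a + 1 ≤ t := by
        intro a ha
        rw [← outDegree_insert_of_notMem hi]
        · exact h a ha
        · intro hA
          have : flipCoord a i ∈ A ∩ subcube x T :=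
            Finset.mem_inter.2 ⟨hA, (hmem x a).1 (Finset.mem_inter.1 ha).2⟩
          simp [h0] at this
      obtain ⟨a, ha⟩ := hne
      obtain ⟨t, rfl⟩ : ∃ u, t = u + 1 := ⟨t - 1, by have := hout a ha; omega⟩
      rw [Finset.card_insert_of_notMem hi]
      rcases ih (flipCoord x i) t ⟨a, ha⟩ fun b hb => by have := hout b hb; omega with
        ⟨c, R, hR, hc, hcard⟩ | hbig
      · exact Or.inl ⟨c, R, hR.trans (Finset.subset_insert i T), hc, by omega⟩
      · right
        rw [pow_succ, pow_succ _ (t + 1)]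
        linarith
    have hflip : subcube (flipCoord x i) (insert i T) = subcube x (insert i T) :=
      subcube_eq_of_mem ((flipCoord_mem_subcube (by simp)).2 (self_mem_subcube x _))
    rcases Finset.eq_empty_or_nonempty (A ∩ subcube x T) with h0 | h0
    · exact key x hne h h0
    rcases Finset.eq_empty_or_nonempty (A ∩ subcube (flipCoord x i) T) with h1 | h1
    · rw [← hflip] at hne h ⊢
      exact key _ hne h h1
    have hdeg0 : ∀ a ∈ A ∩ subcube x T, outDegree A (insert i T) a ≤ t := fun a ha => h a (by
      rw [subcube_insert, Finset.inter_union_distrib_left]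
      exact Finset.mem_union_left _ ha)
    have hdeg1 : ∀ a ∈ A ∩ subcube (flipCoord x i) T, outDegree A (insert i T) a ≤ t :=
      fun a ha => h a (by
        rw [subcube_insert, Finset.inter_union_distrib_left]
        exact Finset.mem_union_right _ ha)
    have hmono := fun a => outDegree_mono A (Finset.subset_insert i T) a
    rcases ih x t h0 fun a ha => (hmono a).trans (hdeg0 a ha) with
      ⟨c, R, hR, hc, hcard⟩ | hbig <;>
    rcases ih (flipCoord x i) t h1 fun a ha => (hmono a).trans (hdeg1 a ha) with
      ⟨c', R', hR', hc', hcard'⟩ | hbig'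
    · left
      refine ⟨c, insert i R, Finset.insert_subset_insert i hR, ?_, ?_⟩
      · have hA1 : A ∩ subcube (flipCoord x i) T = subcube (flipCoord c i) R := by
          ext y
          have hcy : y ∈ subcube (flipCoord c i) R ↔ flipCoord y i ∈ subcube c R := by
            have := flipCoord_mem_subcube_flipCoord (x := flipCoord c i) (y := y) (T := R) (j := i)
            rw [flipCoord_flipCoord] at this
            exact this.symm
          rw [hcy, ← hc]
          constructor
          · intro hy
            exact Finset.mem_inter.2 ⟨flipCoord_mem_of_inter_eq_subcube hi hc' hcard' hy
              (hdeg1 y hy), (hmem x y).1 (Finset.mem_inter.1 hy).2⟩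
          · intro hy
            have := flipCoord_mem_of_inter_eq_subcube hi hc hcard hy (hdeg0 _ hy)
            rw [flipCoord_flipCoord] at this
            exact Finset.mem_inter.2 ⟨this, (hmem x y).2 (Finset.mem_inter.1 hy).2⟩
        rw [subcube_insert, Finset.inter_union_distrib_left, hc, hA1, subcube_insert]
      · rw [Finset.card_insert_of_notMem hi, Finset.card_insert_of_notMem fun hiR => hi (hR hiR)]
        omega
    · exact Or.inr (card_le_of_half_eq_subcube hi hc hcard h hbig')
    · right
      have hx : flipCoord (flipCoord x i) i = x := flipCoord_flipCoord x i
      have := card_le_of_half_eq_subcube (x := flipCoord x i) hi hc' hcard'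
        (by rwa [hflip]) (by rwa [hx])
      rwa [hflip] at this
    · right
      rw [card_inter_subcube_insert A x hi, Finset.card_insert_of_notMem hi, pow_succ, mul_add]
      linarith

theorem subcube_subset_of_forall_flipCoord_mem {F : Finset (Fin n → Bool)} {T : Finset (Fin n)}
    {x : Fin n → Bool} (hx : x ∈ F)
    (h : ∀ y ∈ subcube x T, y ∈ F → ∀ j ∈ T, flipCoord y j ∈ F) : subcube x T ⊆ F := by
  induction T using Finset.induction_on generalizing x with
  | empty => simpa [subcube_empty] using hx
  | insert i T hi ih =>
    have hxi : flipCoord x i ∈ F := h x (self_mem_subcube _ _) hx i (by simp)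
    rw [subcube_insert] at h ⊢
    refine Finset.union_subset (ih hx fun y hy hyF j hj => ?_) (ih hxi fun y hy hyF j hj => ?_)
    · exact h y (Finset.mem_union_left _ hy) hyF j (Finset.mem_insert_of_mem hj)
    · exact h y (Finset.mem_union_right _ hy) hyF j (Finset.mem_insert_of_mem hj)

/-- The points outside `F` having a neighbour in `F`. -/
def outerBoundary (F : Finset (Fin n → Bool)) : Finset (Fin n → Bool) :=
  Finset.univ.filter fun y => y ∉ F ∧ ∃ i, flipCoord y i ∈ F

/-- If `F` contains the fourth vertex of every square of which it contains a path of three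
vertices, then within any subcube not contained in `F`, the outer boundary is at least as large
as `F`. -/
theorem subcube_subset_or_card_le_outerBoundary {F : Finset (Fin n → Bool)}
    (hF : ∀ x a b, x ∈ F → flipCoord x a ∈ F → flipCoord x b ∈ F →
      flipCoord (flipCoord x a) b ∈ F) (T : Finset (Fin n)) (x : Fin n → Bool) :
    subcube x T ⊆ F ∨ (F ∩ subcube x T).card ≤ (outerBoundary F ∩ subcube x T).card := by
  induction T using Finset.induction_on generalizing x with
  | empty =>
    rw [subcube_empty]
    by_cases hx : x ∈ F
    · left; simpa using hx
    · right
      rw [Finset.inter_singleton_of_notMem hx]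
      simp
  | insert i T hi ih =>
    have key : ∀ x : Fin n → Bool, subcube x T ⊆ F → subcube x (insert i T) ⊆ F ∨
        (F ∩ subcube x (insert i T)).card ≤ (outerBoundary F ∩ subcube x (insert i T)).card := by
      intro x hx
      have hmem : ∀ y ∈ subcube (flipCoord x i) T, flipCoord y i ∈ F := by
        intro y hy
        have := (flipCoord_mem_subcube_flipCoord (j := i)).2 hy
        rw [flipCoord_flipCoord] at this
        exact hx this
      by_cases hex : ∃ y ∈ subcube (flipCoord x i) T, y ∈ F
      · obtain ⟨y, hy, hyF⟩ := hex
        left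
        rw [subcube_insert]
        refine Finset.union_subset hx ?_
        rw [← subcube_eq_of_mem hy]
        refine subcube_subset_of_forall_flipCoord_mem hyF fun w hw hwF j hj => ?_
        rw [subcube_eq_of_mem hy] at hw
        have h1 := hmem w hw
        have h2 := hmem (flipCoord w j) ((flipCoord_mem_subcube hj).2 hw)
        have := hF (flipCoord w i) i j h1 (by rwa [flipCoord_flipCoord])
          (by rwa [flipCoord_comm])
        rwa [flipCoord_flipCoord] at this
      · right
        push Not at hex
        have hFe : F ∩ subcube (flipCoord x i) T = ∅ := by
          ext y
          simp only [Finset.mem_inter, Finset.notMem_empty, iff_false, not_and]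
          exact fun hyF hy => hex y hy hyF
        have hNe : outerBoundary F ∩ subcube (flipCoord x i) T = subcube (flipCoord x i) T := by
          refine Finset.inter_eq_right.2 fun y hy => ?_
          exact Finset.mem_filter.2 ⟨Finset.mem_univ _, hex y hy, i, hmem y hy⟩
        rw [card_inter_subcube_insert F x hi, card_inter_subcube_insert _ x hi, hFe, hNe,
          Finset.inter_eq_right.2 hx, card_subcube, card_subcube, Finset.card_empty]
        omega
    have hflip : subcube (flipCoord x i) (insert i T) = subcube x (insert i T) :=
      subcube_eq_of_mem ((flipCoord_mem_subcube (by simp)).2 (self_mem_subcube x _))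
    rcases ih x with h0 | h0
    · exact key x h0
    rcases ih (flipCoord x i) with h1 | h1
    · have := key _ h1
      rwa [hflip] at this
    · right
      rw [card_inter_subcube_insert F x hi, card_inter_subcube_insert _ x hi]
      omega

theorem sum_card_filter_mem {ι : Type*} (A : ι → Finset (Fin n → Bool)) (L : Finset ι) :
    ∑ x, (L.filter fun i => x ∈ A i).card = ∑ i ∈ L, (A i).card := by
  simp_rw [Finset.card_filter]
  rw [Finset.sum_comm]
  refine Finset.sum_congr rfl fun i _ => ?_
  rw [← Finset.card_filter]
  simp

/-- A family of nonempty sets with at most `t` outside neighbours at each point, covering every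
point at most `s` times, has at most `2 ^ t * (s - 1 / 3)` members, provided that a point
covered `s` times by subcubes of the family lies in every member of the family containing one of
its neighbours. -/
theorem three_mul_card_add_le {ι : Type*} (A : ι → Finset (Fin n → Bool)) (P : Finset ι)
    {s t : ℕ} (hs : 0 < s) (ht : 0 < t) (hne : ∀ i ∈ P, (A i).Nonempty)
    (hdeg : ∀ i ∈ P, ∀ a ∈ A i, outDegree (A i) Finset.univ a ≤ t)
    (hcover : ∀ x, (P.filter fun i => x ∈ A i).card ≤ s)
    (hfull : ∀ L ⊆ P, (∀ i ∈ L, ∀ a ∈ A i, t ≤ outDegree (A i) Finset.univ a) →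
      ∀ x, s ≤ (L.filter fun i => x ∈ A i).card → ∀ j ∈ P, ∀ a, flipCoord x a ∈ A j → x ∈ A j) :
    3 * P.card + 2 ^ t ≤ 2 ^ t * (3 * s) := by
  classical
  set L := P.filter fun i => ∃ c R, A i = subcube c R ∧ n = R.card + t with hL
  set H := P.filter fun i => ¬ ∃ c R, A i = subcube c R ∧ n = R.card + t with hH
  have hLP : L ⊆ P := Finset.filter_subset _ _
  have hHP : H ⊆ P := Finset.filter_subset _ _
  have hLcard : ∀ i ∈ L, 2 ^ t * (A i).card = 2 ^ n := by
    intro i hi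
    obtain ⟨c, R, hA, hn⟩ := (Finset.mem_filter.1 hi).2
    rw [hA, card_subcube, ← pow_add, add_comm, ← hn]
  have hHcard : ∀ i ∈ H, 3 * 2 ^ n ≤ 2 ^ (t + 1) * (A i).card := by
    intro i hi
    have hiP := hHP hi
    obtain ⟨a, ha⟩ := hne i hiP
    have := eq_subcube_or_card_le_of_outDegree_le (A i) Finset.univ a t
      (by rw [subcube_univ, Finset.inter_univ]; exact ⟨a, ha⟩)
      (by rw [subcube_univ, Finset.inter_univ]; exact hdeg i hiP)
    rw [subcube_univ, Finset.inter_univ, Finset.card_univ, Fintype.card_fin] at this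
    rcases this with ⟨c, R, -, hc, hR⟩ | h
    · exact absurd ⟨c, R, hc, hR⟩ (Finset.mem_filter.1 hi).2
    · exact h
  have hsplit : ∀ x, (L.filter fun i => x ∈ A i).card + (H.filter fun i => x ∈ A i).card ≤ s := by
    intro x
    refine le_trans (le_of_eq ?_) (hcover x)
    rw [hL, hH, Finset.filter_filter, Finset.filter_filter,
      ← Finset.card_filter_add_card_filter_not (s := P.filter fun i => x ∈ A i)
        (fun i => ∃ c R, A i = subcube c R ∧ n = R.card + t), Finset.filter_filter,
      Finset.filter_filter]
    simp only [and_comm]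
  have hPcard : L.card + H.card = P.card := Finset.card_filter_add_card_filter_not _
  have hstep := hfull L hLP (by
    intro i hi a ha
    obtain ⟨c, R, hA, hn⟩ := (Finset.mem_filter.1 hi).2
    refine le_outDegree_of_inter_eq_subcube (x := a) (c := c) (R := R) ?_ ?_ ?_
    · rw [subcube_univ, Finset.inter_univ, hA]
    · rwa [Finset.card_univ, Fintype.card_fin]
    · rwa [subcube_univ, Finset.inter_univ])
  set F : Finset (Fin n → Bool) :=
    Finset.univ.filter fun x => s ≤ (L.filter fun i => x ∈ A i).card with hF
  have hmemF : ∀ x, x ∈ F ↔ s ≤ (L.filter fun i => x ∈ A i).card := fun x => by simp [hF]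
  have hsquare : ∀ x a b, x ∈ F → flipCoord x a ∈ F → flipCoord x b ∈ F →
      flipCoord (flipCoord x a) b ∈ F := by
    intro x a b hx hxa hxb
    rw [hmemF] at hx hxa hxb ⊢
    refine hx.trans (Finset.card_le_card fun i hi => ?_)
    rw [Finset.mem_filter] at hi ⊢
    refine ⟨hi.1, ?_⟩
    have ha := hstep _ hxa i (hLP hi.1) a (by rw [flipCoord_flipCoord]; exact hi.2)
    have hb := hstep _ hxb i (hLP hi.1) b (by rw [flipCoord_flipCoord]; exact hi.2)
    obtain ⟨c, R, hA, -⟩ := (Finset.mem_filter.1 hi.1).2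
    rw [hA] at ha hb hi ⊢
    by_cases hbR : b ∈ R
    · exact (flipCoord_mem_subcube hbR).2 ha
    · exact absurd hb (flipCoord_notMem_subcube hbR hi.2)
  have hFN : F.card ≤ (outerBoundary F).card := by
    have := subcube_subset_or_card_le_outerBoundary hsquare Finset.univ fun _ => false
    rw [subcube_univ, Finset.inter_univ, Finset.inter_univ] at this
    refine this.resolve_left fun huniv => ?_
    have hall : ∀ x, x ∈ F := fun x => huniv (Finset.mem_univ x)
    have h0 := (hmemF _).1 (hall fun _ => false)
    obtain ⟨i, hi⟩ := Finset.card_pos.1 (hs.trans_le h0)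
    rw [Finset.mem_filter] at hi
    obtain ⟨c, R, hA, hn⟩ := (Finset.mem_filter.1 hi.1).2
    obtain ⟨d, hd⟩ : ∃ d, d ∉ R := by
      by_contra! hcon
      have : R = Finset.univ := Finset.eq_univ_of_forall hcon
      rw [this, Finset.card_univ, Fintype.card_fin] at hn
      omega
    have h1 := hstep _ ((hmemF _).1 (hall (flipCoord (fun _ => false) d))) i (hLP hi.1) d
      (by rw [flipCoord_flipCoord]; exact hi.2)
    rw [hA] at h1 hi
    exact flipCoord_notMem_subcube hd hi.2 h1
  have hpoint : ∀ x, 3 * (L.filter fun i => x ∈ A i).card +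
      2 * (H.filter fun i => x ∈ A i).card + 1 + 2 * (if x ∈ outerBoundary F then 1 else 0) ≤
      3 * s + (if x ∈ F then 1 else 0) := by
    intro x
    have h1 := hsplit x
    by_cases hx : x ∈ F
    · have hN : x ∉ outerBoundary F := fun h => (Finset.mem_filter.1 h).2.1 hx
      rw [if_pos hx, if_neg hN]
      omega
    · have h2 : (L.filter fun i => x ∈ A i).card < s := by
        rw [hmemF] at hx; omega
      rw [if_neg hx]
      by_cases hN : x ∈ outerBoundary F
      · rw [if_pos hN]
        obtain ⟨-, -, a, ha⟩ := Finset.mem_filter.1 hN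
        rw [hmemF] at ha
        have h3 : (H.filter fun i => x ∈ A i).card = 0 := by
          rw [Finset.card_eq_zero, Finset.filter_eq_empty_iff]
          intro j hj hxj
          have h4 := hstep _ ha j (hHP hj) a (by rwa [flipCoord_flipCoord])
          have h5 := hsplit (flipCoord x a)
          have h6 : 0 < (H.filter fun i => flipCoord x a ∈ A i).card :=
            Finset.card_pos.2 ⟨j, Finset.mem_filter.2 ⟨hj, h4⟩⟩
          omega
        omega
      · rw [if_neg hN]
        omega
  have hsum := Finset.sum_le_sum fun x (_ : x ∈ (Finset.univ : Finset (Fin n → Bool))) => hpoint x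
  simp only [Finset.sum_add_distrib, ← Finset.mul_sum, sum_card_filter_mem] at hsum
  have hind : ∀ S : Finset (Fin n → Bool), ∑ x, (if x ∈ S then 1 else 0) = S.card := by
    intro S; simp
  rw [hind, hind] at hsum
  simp only [Finset.sum_const, Finset.card_univ, Fintype.card_fun, Fintype.card_bool,
    Fintype.card_fin, smul_eq_mul, mul_one] at hsum
  have hLsum : 2 ^ t * ∑ i ∈ L, (A i).card = L.card * 2 ^ n := by
    rw [Finset.mul_sum, Finset.sum_congr rfl hLcard, Finset.sum_const, smul_eq_mul]
  have hHsum : H.card * (3 * 2 ^ n) ≤ 2 ^ (t + 1) * ∑ i ∈ H, (A i).card := by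
    rw [Finset.mul_sum, ← smul_eq_mul, ← Finset.sum_const]
    exact Finset.sum_le_sum hHcard
  have hsum' : 3 * ∑ i ∈ L, (A i).card + 2 * ∑ i ∈ H, (A i).card + 2 ^ n ≤ 2 ^ n * (3 * s) := by
    linarith
  have hfinal := Nat.mul_le_mul_left (2 ^ t) hsum'
  rw [pow_succ] at hHsum
  refine Nat.le_of_mul_le_mul_right (c := 2 ^ n) ?_ (by positivity)
  rw [← hPcard]
  linarith

end Flip

theorem sensAt_le_bSens {n : ℕ} {f : (Fin n → Bool) → Bool} {b : Bool} {x : Fin n → Bool}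
    (hx : f x = b) : sensAt f x ≤ bSens f b :=
  Finset.le_sup (f := sensAt f) (by simpa using hx)

theorem exists_certificate {n : ℕ} (f : (Fin n → Bool) → Bool) (z : Fin n → Bool) :
    ∃ P : Finset (Fin n), P.card = certAt f z ∧ (∀ y, (∀ i ∈ P, y i = z i) → f y = f z) ∧
      ∀ i ∈ P, ∃ y, (∀ j ∈ P, j ≠ i → y j = z j) ∧ f y ≠ f z := by
  have hne : {k | ∃ P : Finset (Fin n), P.card = k ∧
      ∀ y : Fin n → Bool, (∀ i ∈ P, y i = z i) → f y = f z}.Nonempty :=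
    ⟨_, Finset.univ, rfl, fun y hy => by rw [funext fun i => hy i (Finset.mem_univ i)]⟩
  obtain ⟨P, hP, hcert⟩ := Nat.sInf_mem hne
  refine ⟨P, hP, hcert, fun i hi => ?_⟩
  by_contra! hcon
  have hle : certAt f z ≤ (P.erase i).card :=
    Nat.sInf_le ⟨P.erase i, rfl, fun y hy => hcon y fun j hj hji =>
      hy j (Finset.mem_erase.2 ⟨hji, hj⟩)⟩
  have hlt := Finset.card_erase_lt_of_mem hi
  unfold certAt at hle
  omega

theorem three_mul_certAt_add_le {n : ℕ} (f : (Fin n → Bool) → Bool) (hs0 : 0 < bSens f false)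
    (hs1 : 1 < bSens f true) {z : Fin n → Bool} (hz : f z = false) :
    3 * certAt f z + 2 ^ (bSens f true - 1) ≤
      2 ^ (bSens f true - 1) * (3 * bSens f false) := by
  obtain ⟨P, hP, hcert, hmin⟩ := exists_certificate f z
  rw [hz] at hcert hmin
  rw [← hP]
  set g : (Fin n → Bool) → Fin n → Bool := fun x j => if j ∈ P then z j else x j with hg
  have hg0 : ∀ x, f (g x) = false := fun x => hcert _ fun i hi => by simp [hg, hi]
  have hg_mem : ∀ x, ∀ j ∈ P, g (flipCoord x j) = g x := by
    intro x j hj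
    ext k
    by_cases hk : k ∈ P
    · simp [hg, hk]
    · simp only [hg, hk, if_false]
      exact flipCoord_of_ne _ (by rintro rfl; exact hk hj)
  have hg_notMem : ∀ x, ∀ j ∉ P, g (flipCoord x j) = flipCoord (g x) j := by
    intro x j hj
    ext k
    by_cases hk : k ∈ P
    · rw [flipCoord_of_ne _ (by rintro rfl; exact hj hk)]
      simp [hg, hk]
    · by_cases hkj : k = j
      · subst hkj
        rw [flipCoord_same]
        simp [hg, hk, flipCoord_same]
      · rw [flipCoord_of_ne _ hkj]
        simp [hg, hk, flipCoord_of_ne _ hkj]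
  set A : Fin n → Finset (Fin n → Bool) :=
    fun i => Finset.univ.filter fun x => f (flipCoord (g x) i) = true with hAdef
  have hA : ∀ i x, x ∈ A i ↔ f (flipCoord (g x) i) = true := fun i x => by simp [hAdef]
  have hdeg : ∀ i ∈ P, ∀ a ∈ A i, outDegree (A i) Finset.univ a + 1 +
      (P.filter fun j => j ≠ i ∧ f (flipCoord (flipCoord (g a) i) j) = false).card ≤
      bSens f true := by
    intro i hi a ha
    rw [hA] at ha
    refine le_trans ?_ (sensAt_le_bSens ha)
    have hout : ∀ j, flipCoord a j ∉ A i → j ∉ P := by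
      intro j hj hjP
      rw [hA, hg_mem a j hjP] at hj
      exact hj ha
    have h1 : i ∉ Finset.univ.filter fun j => flipCoord a j ∉ A i := by
      intro h
      exact hout i (Finset.mem_filter.1 h).2 hi
    unfold outDegree sensAt
    rw [← Finset.card_insert_of_notMem h1, ← Finset.card_union_of_disjoint]
    · refine Finset.card_le_card fun j hj => ?_
      refine Finset.mem_filter.2 ⟨Finset.mem_univ j, ?_⟩
      rw [ha]
      rcases Finset.mem_union.1 hj with hj | hj
      · rcases Finset.mem_insert.1 hj with rfl | hj
        · rw [flipCoord_flipCoord, hg0]; decide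
        · have hj := (Finset.mem_filter.1 hj).2
          have hjP := hout j hj
          rwa [hA, hg_notMem a j hjP, flipCoord_comm] at hj
      · rw [(Finset.mem_filter.1 hj).2.2]; decide
    · rw [Finset.disjoint_left]
      intro j hj hj'
      rw [Finset.mem_filter] at hj'
      rcases Finset.mem_insert.1 hj with rfl | hj
      · exact hj'.2.1 rfl
      · exact hout j (Finset.mem_filter.1 hj).2 hj'.1
  refine three_mul_card_add_le A P hs0 (by omega) ?_ ?_ ?_ ?_
  · intro i hi
    obtain ⟨y, hy, hfy⟩ := hmin i hi
    refine ⟨y, (hA i y).2 ?_⟩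
    have hyi : y i ≠ z i := by
      intro h
      refine hfy (hcert y fun j hj => ?_)
      by_cases hji : j = i
      · rw [hji, h]
      · exact hy j hj hji
    have : flipCoord (g y) i = y := by
      ext k
      by_cases hki : k = i
      · subst hki
        rw [flipCoord_same]
        simp only [hg, hi, if_true]
        cases hy1 : y k <;> cases hz1 : z k <;> simp_all
      · rw [flipCoord_of_ne _ hki]
        by_cases hk : k ∈ P
        · simp [hg, hk, hy k hk hki]
        · simp [hg, hk]
    rw [this]
    simpa using hfy
  · intro i hi a ha
    have := hdeg i hi a ha
    omega
  · intro x
    refine le_trans (Finset.card_le_card fun i hi => ?_) (sensAt_le_bSens (hg0 x))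
    have := (hA i x).1 (Finset.mem_filter.1 hi).2
    simp [this, hg0]
  · intro L hLP hL x hx j hj a ha
    by_contra hxj
    have haP : a ∉ P := by
      intro haP
      rw [hA, hg_mem x a haP, ← hA] at ha
      exact hxj ha
    have hxj0 : f (flipCoord (g x) j) = false := by
      rw [hA] at hxj
      simpa using hxj
    rw [hA, hg_notMem x a haP, flipCoord_comm] at ha
    have hlight : ∀ i ∈ L, x ∈ A i → f (flipCoord (flipCoord (g x) j) i) = true := by
      intro i hi hxi
      have hij : j ≠ i := by rintro rfl; exact hxj hxi
      by_contra hcon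
      have h1 := hL i hi x hxi
      have h2 := hdeg i (hLP hi) x hxi
      have h3 : 0 < (P.filter fun k => k ≠ i ∧
          f (flipCoord (flipCoord (g x) i) k) = false).card :=
        Finset.card_pos.2 ⟨j, Finset.mem_filter.2 ⟨hj, hij, by
          rw [flipCoord_comm]; simpa using hcon⟩⟩
      omega
    have haL : a ∉ L.filter fun i => x ∈ A i := fun h => haP (hLP (Finset.mem_filter.1 h).1)
    have h1 : (insert a (L.filter fun i => x ∈ A i)).card ≤ sensAt f (flipCoord (g x) j) := by
      refine Finset.card_le_card fun i hi => ?_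
      refine Finset.mem_filter.2 ⟨Finset.mem_univ i, ?_⟩
      rw [hxj0]
      rcases Finset.mem_insert.1 hi with rfl | hi
      · rw [ha]; decide
      · rw [Finset.mem_filter] at hi
        rw [hlight i hi.1 hi.2]; decide
    have h2 := sensAt_le_bSens hxj0
    rw [Finset.card_insert_of_notMem haL] at h1
    omega

theorem bSens_false_pos {n : ℕ} {f : (Fin n → Bool) → Bool} (h : 0 < bSens f true) :
    0 < bSens f false := by
  obtain ⟨x, hx, hpos⟩ := Finset.lt_sup_iff.1 h
  obtain ⟨i, hi⟩ := Finset.card_pos.1 hpos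
  have hfx : f x = true := (Finset.mem_filter.1 hx).2
  have hfi : f (flipCoord x i) = false := by
    have := (Finset.mem_filter.1 hi).2
    rw [hfx] at this
    simpa using this
  refine lt_of_lt_of_le ?_ (sensAt_le_bSens hfi)
  exact Finset.card_pos.2 ⟨i, by simp [hfx, hfi]⟩

/-- **Theorem 1 (main upper bound, case `s₁(f) > 1`).**
If `f` is non-constant and `s₁(f) > 1`, then `C₀(f) ≤ 2^(s₁(f)-1) · (s₀(f) - 1/3)`. -/
theorem cert0_le_of_one_lt_sens1 {n : ℕ} (f : (Fin n → Bool) → Bool)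
    (hnc : NonConstant f) (hs1 : 1 < bSens f true) :
    (bCert f false : ℚ) ≤ 2 ^ (bSens f true - 1) * ((bSens f false : ℚ) - 1 / 3) := by
  obtain ⟨x, y, hxy⟩ := hnc
  obtain ⟨w, hw⟩ : ∃ w, f w = false := by
    cases hx : f x
    · exact ⟨x, hx⟩
    · exact ⟨y, by rw [hx] at hxy; simpa using hxy.symm⟩
  obtain ⟨z, hz, hzc⟩ := Finset.exists_mem_eq_sup (Finset.univ.filter fun x => f x = false)
    ⟨w, by simp [hw]⟩ (certAt f)
  have hmain := three_mul_certAt_add_le f (bSens_false_pos (by omega)) hs1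
    (Finset.mem_filter.1 hz).2
  rw [← hzc] at hmain
  change 3 * bCert f false + _ ≤ _ at hmain
  have hq : (3 * bCert f false + 2 ^ (bSens f true - 1) : ℚ) ≤
      2 ^ (bSens f true - 1) * (3 * bSens f false) := by
    exact_mod_cast hmain
  linarith
end

section
/- Let f : {0,1}^n → {0,1} be a non-constant Boolean function with s_1(f) = 1. Then C_0(f) = s_0(f). -/
theorem flipCoord_apply_of_ne {n : ℕ} (x : Fin n → Bool) {i j : Fin n} (h : j ≠ i) :
    flipCoord x i j = x j := by
  simp [flipCoord, h]

theorem flipCoord_apply_self {n : ℕ} (x : Fin n → Bool) (i : Fin n) :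
    flipCoord x i i = !(x i) := by
  simp [flipCoord]

/-- Every certificate on `x` contains all coordinates that are sensitive on `x`. -/
theorem sensAt_le_certAt {n : ℕ} (f : (Fin n → Bool) → Bool) (x : Fin n → Bool) :
    sensAt f x ≤ certAt f x := by
  refine le_csInf ⟨_, Finset.univ, rfl, fun y hy => ?_⟩ ?_
  · rw [funext fun i => hy i (Finset.mem_univ i)]
  · rintro k ⟨P, rfl, hP⟩
    refine Finset.card_le_card fun i hi => ?_
    by_contra hiP
    refine (Finset.mem_filter.1 hi).2 (hP _ fun j hj => ?_)
    exact flipCoord_apply_of_ne x fun h => hiP (h ▸ hj)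

/-- If every `1`-input has at most one sensitive coordinate, then the sensitive coordinates
of a `0`-input form a certificate. -/
theorem eq_false_of_agree_on_sensitive {n : ℕ} (f : (Fin n → Bool) → Bool)
    (hs : ∀ y, f y = true → sensAt f y ≤ 1) (x : Fin n → Bool) (hx : f x = false)
    (y : Fin n → Bool) (hy : ∀ i, f (flipCoord x i) ≠ f x → y i = x i) :
    f y = false := by
  induction hd : (Finset.univ.filter fun i => y i ≠ x i).card using Nat.strong_induction_on
    generalizing y with
  | _ d ih =>
    have flip_false : ∀ i, y i ≠ x i → f (flipCoord y i) = false := by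
      intro i hi
      refine ih _ ?_ (flipCoord y i) (fun j hj => ?_) rfl
      · rw [← hd]
        refine Finset.card_lt_card (Finset.ssubset_iff_of_subset ?_ |>.2 ⟨i, ?_, ?_⟩)
        · intro j hj
          rcases eq_or_ne j i with rfl | hji
          · simpa using hi
          · simpa [flipCoord_apply_of_ne y hji] using hj
        · simpa using hi
        · simpa [flipCoord_apply_self] using hi
      · have hji : j ≠ i := by
          rintro rfl
          exact hi (hy j hj)
        rw [flipCoord_apply_of_ne y hji, hy j hj]
    by_contra hfy
    rw [Bool.not_eq_false] at hfy
    have hsub : (Finset.univ.filter fun i => y i ≠ x i).card ≤ 1 := by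
      refine (Finset.card_le_card fun i hi => ?_).trans (hs y hfy)
      simp [hfy, flip_false i (Finset.mem_filter.1 hi).2]
    by_cases hyx : y = x
    · simp [hyx, hx] at hfy
    · obtain ⟨i, hi⟩ := Function.ne_iff.1 hyx
      have hflip : flipCoord x i = y := by
        funext j
        rcases eq_or_ne j i with rfl | hji
        · rw [flipCoord_apply_self]
          exact (Bool.eq_not.2 hi).symm
        · rw [flipCoord_apply_of_ne x hji]
          by_contra hj
          exact hji (Finset.card_le_one.1 hsub j (by simpa using Ne.symm hj) i (by simpa using hi))
      exact hi (hy i (by simp [hflip, hfy, hx]))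

/-- **Theorem 1 (case `s₁(f) = 1`).**
If `f` is non-constant and `s₁(f) = 1`, then `C₀(f) = s₀(f)`. -/
theorem cert0_eq_sens0_of_sens1_eq_one {n : ℕ} (f : (Fin n → Bool) → Bool)
    (hnc : NonConstant f) (hs1 : bSens f true = 1) :
    bCert f false = bSens f false := by
  have hs : ∀ y, f y = true → sensAt f y ≤ 1 := fun y hy =>
    hs1 ▸ Finset.le_sup (f := sensAt f) (Finset.mem_filter.2 ⟨Finset.mem_univ y, hy⟩)
  refine Finset.sup_congr rfl fun x hx => le_antisymm ?_ (sensAt_le_certAt f x)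
  have hfx : f x = false := (Finset.mem_filter.1 hx).2
  refine Nat.sInf_le ⟨_, rfl, fun y hy => ?_⟩
  rw [hfx]
  exact eq_false_of_agree_on_sensitive f hs x hfx y fun i hi => hy i (by simpa using hi)
end

section
/- Let Sort_4 : {0,1}^4 → {0,1} be defined by Sort_4(x) = 1 iff (x_1 ≤ x_2 ≤ x_3 ≤ x_4) or (x_1 ≥ x_2 ≥ x_3 ≥ x_4). Then C_0(Sort_4) = 3, s_0(Sort_4) = 2, and s_1(Sort_4) = 2. -/
/-- The function `Sort₄` on 4 bits: `1` iff the bits are in ascending or descending order. -/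
def sort4 : (Fin 4 → Bool) → Bool :=
  fun x => decide ((x 0 ≤ x 1 ∧ x 1 ≤ x 2 ∧ x 2 ≤ x 3) ∨
                   (x 1 ≤ x 0 ∧ x 2 ≤ x 1 ∧ x 3 ≤ x 2))

theorem certAt_le_card {n : ℕ} {f : (Fin n → Bool) → Bool} {x : Fin n → Bool}
    (P : Finset (Fin n)) (hP : ∀ y : Fin n → Bool, (∀ i ∈ P, y i = x i) → f y = f x) :
    certAt f x ≤ P.card :=
  Nat.sInf_le ⟨P, rfl, hP⟩

theorem le_certAt {n k : ℕ} {f : (Fin n → Bool) → Bool} {x : Fin n → Bool}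
    (h : ∀ P : Finset (Fin n),
      (∀ y : Fin n → Bool, (∀ i ∈ P, y i = x i) → f y = f x) → k ≤ P.card) :
    k ≤ certAt f x := by
  refine le_csInf ⟨_, Finset.univ, rfl, fun y hy => ?_⟩ ?_
  · rw [funext fun i => hy i (Finset.mem_univ i)]
  · rintro _ ⟨P, rfl, hP⟩
    exact h P hP

theorem exists_card_le_three_certificate_of_sort4_eq_false :
    ∀ x : Fin 4 → Bool, sort4 x = false → ∃ P : Finset (Fin 4), P.card ≤ 3 ∧
      ∀ y : Fin 4 → Bool, (∀ i ∈ P, y i = x i) → sort4 y = sort4 x := by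
  decide +kernel

theorem three_le_card_of_certificate_sort4 :
    ∀ P : Finset (Fin 4), (∀ y : Fin 4 → Bool,
      (∀ i ∈ P, y i = ![false, true, false, true] i) →
        sort4 y = sort4 ![false, true, false, true]) → 3 ≤ P.card := by
  decide +kernel

theorem bCert_sort4_false : bCert sort4 false = 3 := by
  apply le_antisymm
  · refine Finset.sup_le fun x hx => ?_
    obtain ⟨P, hcard, hP⟩ :=
      exists_card_le_three_certificate_of_sort4_eq_false x (Finset.mem_filter.1 hx).2
    exact (certAt_le_card P hP).trans hcard
  · exact (le_certAt three_le_card_of_certificate_sort4).trans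
      (Finset.le_sup (f := certAt sort4) (by decide))

/-- `C₀(Sort₄) = 3`, `s₀(Sort₄) = 2`, `s₁(Sort₄) = 2`. -/
theorem sort4_complexity_measures :
    bCert sort4 false = 3 ∧ bSens sort4 false = 2 ∧ bSens sort4 true = 2 :=
  ⟨bCert_sort4_false, by decide +kernel, by decide +kernel⟩
end
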